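/- The numbers a_n of well-labelled Motzkin paths satisfy, for all n ≥ 0, the recurrence: a_n = [n=2] + n·a_{n-1} + (1/2)·Σ_{k=0}^{n} C(n,k)·a_k·a_{n-k}, where [n=2] is 1 if n=2 and 0 otherwise, and a_0 = a_1 = 0 (interpret a_{-1} = 0). -/

import Mathlib

/-- The steps of the word are letters in `{-1,0,+1}`. -/
def StepsOK (n : ℕ) (p : Fin (n - 1) → ℤ) : Prop :=
  ∀ i, p i = -1 ∨ p i = 0 ∨ p i = 1

/-- Compatibility between the word and the permutation: a `-1` step forces an ascent
of the labels and a `+1` step forces a descent. -/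
def Compat (n : ℕ) (p : Fin (n - 1) → ℤ) (σ : Equiv.Perm (Fin n)) : Prop :=
  ∀ i : Fin (n - 1),
    (p i = -1 → σ ⟨i.1, by have := i.isLt; omega⟩ < σ ⟨i.1 + 1, by have := i.isLt; omega⟩) ∧
    (p i = 1 → σ ⟨i.1 + 1, by have := i.isLt; omega⟩ < σ ⟨i.1, by have := i.isLt; omega⟩)

/-- Partial sum `p 1 + ... + p j` of the word. -/
def psum (n : ℕ) (p : Fin (n - 1) → ℤ) (j : ℕ) : ℤ :=
  ∑ i ∈ Finset.univ.filter (fun i : Fin (n - 1) => i.1 < j), p i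

/-- Well-labelled positive path of size `n`. -/
def IsPositivePath (n : ℕ) (p : Fin (n - 1) → ℤ) (σ : Equiv.Perm (Fin n)) : Prop :=
  StepsOK n p ∧ Compat n p σ ∧ ∀ j ≤ n - 1, 0 ≤ psum n p j

/-- Well-labelled Motzkin path of size `n`. -/
def IsMotzkinPath (n : ℕ) (p : Fin (n - 1) → ℤ) (σ : Equiv.Perm (Fin n)) : Prop :=
  StepsOK n p ∧ Compat n p σ ∧ (∀ j ≤ n - 2, 0 ≤ psum n p j) ∧ psum n p (n - 1) = -1

/-- Number of well-labelled Motzkin paths of size `n`. -/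
noncomputable def motzkinCount (n : ℕ) : ℕ :=
  Nat.card {ps : (Fin (n - 1) → ℤ) × Equiv.Perm (Fin n) // IsMotzkinPath n ps.1 ps.2}

/-- Number of well-labelled positive paths of size `n`. -/
noncomputable def positiveCount (n : ℕ) : ℕ :=
  Nat.card {ps : (Fin (n - 1) → ℤ) × Equiv.Perm (Fin n) // IsPositivePath n ps.1 ps.2}

/-- Number of horizontal steps (letters `0`) of a word. -/
def horizCount (n : ℕ) (p : Fin (n - 1) → ℤ) : ℕ :=
  (Finset.univ.filter (fun i => p i = 0)).card

/-- Lists `w.1` followed by `w.2` recording a walk from `0` with steps smaller than `N` in absolute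
value, positive until its final, negative, position. -/
def firstPassage (N : ℤ) : Set (List ℤ × ℤ) :=
  {w | (∀ x ∈ w.1, 0 < x) ∧ w.2 < 0 ∧ (0 :: (w.1 ++ [w.2])).IsChain fun a b => |a - b| < N}

/-- The residues modulo `N` of the positions of a walk. -/
def residues (N : ℤ) (w : List ℤ × ℤ) : Multiset ℤ :=
  (((w.1 ++ [w.2] : List ℤ) : Multiset ℤ)).map (· % N)

/-- First passage walks whose residues modulo `N` are the elements of `S`, once each. -/
def labelledPassage (N : ℤ) (S : Finset ℤ) : Set (List ℤ × ℤ) :=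
  {w | w ∈ firstPassage N ∧ residues N w = S.val}

/-- Number of first passage walks of length `n` labelled by all nonzero residues. -/
noncomputable def passageCount (n : ℕ) : ℕ :=
  (labelledPassage (n + 1) (Finset.Ioo 0 ((n : ℤ) + 1))).ncard

lemma finite_chains (N : ℤ) (k : ℕ) (a : ℤ) :
    {l : List ℤ | l.length = k ∧ (a :: l).IsChain fun a b => |a - b| < N}.Finite := by
  induction k generalizing a with
  | zero =>
    refine (Set.finite_singleton []).subset ?_
    rintro l ⟨hl, -⟩
    simpa using hl
  | succ k ih =>
    refine (Set.Finite.biUnion (Finset.Icc (a - N) (a + N)).finite_toSet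
      (fun x _ => (ih x).image (List.cons x))).subset ?_
    rintro (_ | ⟨x, l⟩) ⟨hl, hc⟩
    · simp at hl
    · rw [List.isChain_cons_cons, abs_lt] at hc
      simp only [Set.mem_iUnion, Finset.mem_coe, Finset.mem_Icc]
      exact ⟨x, ⟨by omega, by omega⟩, l, ⟨by simpa using hl, hc.2⟩, rfl⟩

lemma card_residues (N : ℤ) (w : List ℤ × ℤ) : (residues N w).card = w.1.length + 1 := by
  simp [residues]

lemma finite_labelledPassage (N : ℤ) (S : Finset ℤ) : (labelledPassage N S).Finite := by
  refine Set.Finite.of_finite_image (f := fun w => w.1 ++ [w.2])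
    ((finite_chains N S.card 0).subset ?_) ?_
  · rintro _ ⟨w, ⟨⟨-, -, hc⟩, hr⟩, rfl⟩
    refine ⟨?_, hc⟩
    have := card_residues N w
    rw [hr] at this
    simpa using this.symm
  · rintro ⟨u, t⟩ - ⟨u', t'⟩ - h
    simpa using h

/-- The labels `S ∪ {0}` modulo `N`, repeated periodically, are in increasing correspondence with
the integers. -/
lemma exists_periodic_embedding {N : ℤ} {S : Finset ℤ} (hS : S ⊆ Finset.Ioo 0 N) (hN : 0 < N) :
    ∃ φ : ℤ → ℤ, StrictMono φ ∧ φ 0 = 0 ∧ (∀ z, φ (z + (S.card + 1)) = φ z + N) ∧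
      ∀ y, y % N ∈ insert 0 S → y ∈ Set.range φ := by
  have h0 : (0 : ℤ) ∉ S := fun h => by simpa using hS h
  have hcard : (insert 0 S).card = S.card + 1 := Finset.card_insert_of_notMem h0
  set e := (insert 0 S).orderEmbOfFin hcard with he
  have hmem : ∀ i, e i ∈ insert 0 S := fun i => Finset.orderEmbOfFin_mem _ _ _
  have hlt : ∀ i, 0 ≤ e i ∧ e i < N := by
    intro i
    rcases Finset.mem_insert.1 (hmem i) with h | h
    · omega
    · have := Finset.mem_Ioo.1 (hS h)
      omega
  set M : ℤ := S.card + 1 with hM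
  have hMpos : 0 < M := by omega
  have hr : ∀ z : ℤ, (z % M).toNat < S.card + 1 := fun z => by
    have := Int.emod_nonneg z hMpos.ne'
    have := Int.emod_lt_of_pos z hMpos
    omega
  have he0 : e ⟨0, by omega⟩ = 0 := by
    have : (0 : ℤ) ∈ Set.range e := by
      rw [he, Finset.range_orderEmbOfFin]; simp
    obtain ⟨i, hi⟩ := this
    have h1 : e ⟨0, by omega⟩ ≤ e i := e.monotone (Fin.mk_le_of_le_val (Nat.zero_le _))
    have := (hlt ⟨0, by omega⟩).1
    omega
  refine ⟨fun z => N * (z / M) + e ⟨(z % M).toNat, hr z⟩, ?_, ?_, ?_, ?_⟩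
  · refine strictMono_int_of_lt_succ fun z => ?_
    have h1 := Int.emod_nonneg z hMpos.ne'
    have h2 := Int.emod_lt_of_pos z hMpos
    have h3 := Int.mul_ediv_add_emod z M
    by_cases h : z % M + 1 < M
    · have hq : (z + 1) / M = z / M ∧ (z + 1) % M = z % M + 1 :=
        (Int.ediv_emod_unique hMpos).2 ⟨by omega, by omega, by omega⟩
      simp only [hq.1]
      have : e ⟨(z % M).toNat, hr z⟩ < e ⟨((z + 1) % M).toNat, hr (z + 1)⟩ := by
        apply e.strictMono
        rw [Fin.mk_lt_mk, hq.2]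
        omega
      omega
    · have hq : (z + 1) / M = z / M + 1 ∧ (z + 1) % M = 0 :=
        (Int.ediv_emod_unique hMpos).2 ⟨by rw [mul_add]; omega, by omega, by omega⟩
      simp only [hq.1, mul_add]
      have := hlt ⟨(z % M).toNat, hr z⟩
      have := hlt ⟨((z + 1) % M).toNat, hr (z + 1)⟩
      omega
  · simpa using he0
  · intro z
    simp only [Int.add_emod_right, Int.add_ediv_of_dvd_right (dvd_refl M), Int.ediv_self hMpos.ne']
    ring
  · intro y hy
    have : y % N ∈ Set.range e := by rw [he, Finset.range_orderEmbOfFin]; exact hy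
    obtain ⟨i, hi⟩ := this
    have hiM : (i : ℤ) < M := by have := i.isLt; omega
    have hq : (M * (y / N) + i) / M = y / N ∧ (M * (y / N) + i) % M = i :=
      (Int.ediv_emod_unique hMpos).2 ⟨by omega, by omega, hiM⟩
    refine ⟨M * (y / N) + i, ?_⟩
    simp only [hq.1, hq.2, Int.toNat_natCast, Fin.eta, hi]
    exact Int.mul_ediv_add_emod y N

lemma ncard_labelledPassage {N : ℤ} {S : Finset ℤ} (hS : S ⊆ Finset.Ioo 0 N) (hN : 0 < N) :
    (labelledPassage N S).ncard = passageCount S.card := by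
  obtain ⟨φ, hmono, h0, hper, hsurj⟩ := exists_periodic_embedding hS hN
  set M : ℤ := S.card + 1 with hM
  have hMpos : 0 < M := by omega
  have hper' : ∀ (q z : ℤ), φ (z + q * M) = φ z + q * N := by
    intro q
    induction q using Int.induction_on with
    | zero => simp
    | succ q ih => intro z; rw [add_mul, one_mul, ← add_assoc, hper, ih]; ring
    | pred q ih =>
      intro z
      have := hper (z + (-q - 1) * M)
      rw [show z + (-(q : ℤ) - 1) * M + M = z + -q * M by ring, ih] at this
      linarith
  have hmod : ∀ z, φ z % N = φ (z % M) := by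
    intro z
    have h1 : φ z = φ (z % M) + (z / M) * N := by
      rw [← hper']; congr 1; rw [mul_comm]; exact (Int.emod_add_mul_ediv z M).symm
    have h2 : 0 ≤ φ (z % M) := h0 ▸ hmono.monotone (Int.emod_nonneg z hMpos.ne')
    have h3 : φ (z % M) < N := by
      have := hmono (Int.emod_lt_of_pos z hMpos)
      have h4 := hper 0
      rw [zero_add, h0] at h4
      omega
    rw [h1, Int.add_mul_emod_self_right, Int.emod_eq_of_lt h2 h3]
  have hres : ∀ w : List ℤ × ℤ, residues N (w.1.map φ, φ w.2) = (residues M w).map φ := by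
    intro w
    simp [residues, hmod, Function.comp_def]
  have hφM : φ M = N := by have := hper 0; rwa [zero_add, h0, zero_add] at this
  have hfull : (Finset.Ioo 0 M).val.map φ = S.val := by
    refine (Multiset.Nodup.ext ((Finset.nodup _).map hmono.injective) S.nodup).2 fun y => ?_
    simp only [Multiset.mem_map, Finset.mem_val, Finset.mem_Ioo]
    constructor
    · rintro ⟨z, ⟨hz0, hzM⟩, rfl⟩
      have h2 : φ z ∈ Finset.image φ (Finset.Ioo 0 M) :=
        Finset.mem_image_of_mem _ (Finset.mem_Ioo.2 ⟨hz0, hzM⟩)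
      have h3 : S ⊆ Finset.image φ (Finset.Ioo 0 M) := by
        intro y hy
        have hyN := Finset.mem_Ioo.1 (hS hy)
        obtain ⟨x, rfl⟩ := hsurj y (by
          rw [Int.emod_eq_of_lt hyN.1.le hyN.2]; exact Finset.mem_insert_of_mem hy)
        rw [← h0, hmono.lt_iff_lt, ← hφM, hmono.lt_iff_lt] at hyN
        exact Finset.mem_image_of_mem _ (Finset.mem_Ioo.2 hyN)
      have h4 : S = Finset.image φ (Finset.Ioo 0 M) := by
        refine Finset.eq_of_subset_of_card_le h3 (Finset.card_image_le.trans ?_)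
        simp [hM]
      rwa [h4]
    · intro hy
      have hyN := Finset.mem_Ioo.1 (hS hy)
      obtain ⟨x, rfl⟩ := hsurj y (by
        rw [Int.emod_eq_of_lt hyN.1.le hyN.2]; exact Finset.mem_insert_of_mem hy)
      rw [← h0, hmono.lt_iff_lt, ← hφM, hmono.lt_iff_lt] at hyN
      exact ⟨x, hyN, rfl⟩
  have hstep : ∀ a b, |φ a - φ b| < N ↔ |a - b| < M := by
    intro a b
    have h1 : φ a < φ b + N ↔ a < b + M := by rw [← hper b, hmono.lt_iff_lt]
    have h2 : φ b < φ a + N ↔ b < a + M := by rw [← hper a, hmono.lt_iff_lt]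
    rw [abs_lt, abs_lt]
    omega
  have hpos : ∀ a, 0 < φ a ↔ 0 < a := fun a => by
    conv_lhs => rw [← h0]
    exact hmono.lt_iff_lt
  have hneg : ∀ a, φ a < 0 ↔ a < 0 := fun a => by
    conv_lhs => rw [← h0]
    exact hmono.lt_iff_lt
  have hpass : ∀ w : List ℤ × ℤ, (w.1.map φ, φ w.2) ∈ labelledPassage N S ↔
      w ∈ labelledPassage M (Finset.Ioo 0 M) := by
    intro w
    have hc : (0 :: (w.1.map φ ++ [φ w.2])) = (0 :: (w.1 ++ [w.2])).map φ := by simp [h0]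
    simp only [labelledPassage, firstPassage, Set.mem_ofPred_eq, hres, hc, List.isChain_map, hstep,
      List.forall_mem_map, hpos, hneg, ← hfull, (Multiset.map_injective hmono.injective).eq_iff]
  have himage : labelledPassage N S =
      (fun w : List ℤ × ℤ => (w.1.map φ, φ w.2)) '' labelledPassage M (Finset.Ioo 0 M) := by
    ext ⟨u, t⟩
    constructor
    · intro h
      have hall : ∀ x ∈ u ++ [t], x ∈ Set.range φ := by
        intro x hx
        apply hsurj
        refine Finset.mem_insert_of_mem ?_
        rw [← Finset.mem_val, ← h.2]
        exact Multiset.mem_map_of_mem _ hx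
      obtain ⟨u', rfl⟩ : u ∈ Set.range (List.map φ) := by
        rw [Set.range_list_map]
        exact fun x hx => hall x (by simp [hx])
      obtain ⟨t', rfl⟩ := hall t (by simp)
      exact ⟨(u', t'), (hpass (u', t')).1 h, rfl⟩
    · rintro ⟨w, hw, h⟩
      rw [← h]
      exact (hpass w).2 hw
  rw [himage, Set.ncard_image_of_injective, passageCount]
  rintro ⟨u, t⟩ ⟨u', t'⟩ h
  simpa [hmono.injective.eq_iff, (List.map_injective_iff.2 hmono.injective).eq_iff] using h

/-- Pairs of first passage walks whose residues modulo `N` are jointly the nonzero residues, once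
each. -/
def passagePairs (N : ℤ) : Set ((List ℤ × ℤ) × (List ℤ × ℤ)) :=
  {q | q.1 ∈ firstPassage N ∧ q.2 ∈ firstPassage N ∧
    residues N q.1 + residues N q.2 = (Finset.Ioo 0 N).val}

lemma map_sub_emod_Ico {N : ℤ} (hN : 0 < N) (m : ℤ) :
    (Finset.Ico 0 N).val.map (fun r => (r - m) % N) = (Finset.Ico 0 N).val := by
  refine Multiset.eq_of_le_of_card_le ((Multiset.le_iff_subset ?_).2 ?_) (by simp)
  · refine (Finset.nodup _).map_on fun x hx y hy h => ?_
    rw [Finset.mem_val, Finset.mem_Ico] at hx hy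
    have h1 : (x - m + m) % N = (y - m + m) % N := Int.ModEq.add_right m h
    rwa [sub_add_cancel, sub_add_cancel, Int.emod_eq_of_lt hx.1 hx.2,
      Int.emod_eq_of_lt hy.1 hy.2] at h1
  · intro y hy
    obtain ⟨x, -, rfl⟩ := Multiset.mem_map.1 hy
    exact Finset.mem_Ico.2 ⟨Int.emod_nonneg _ hN.ne', Int.emod_lt_of_pos _ hN⟩

lemma residues_shift {N : ℤ} (hN : 0 < N) (m : ℤ) (s : Multiset ℤ)
    (h : s.map (· % N) = (Finset.Ico 0 N).val) :
    (s.map (· - m)).map (· % N) = (Finset.Ico 0 N).val := by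
  conv_rhs => rw [← map_sub_emod_Ico hN m, ← h]
  simp

lemma residues_shift_iff {N : ℤ} (hN : 0 < N) (m : ℤ) (s : Multiset ℤ) :
    (s.map (· - m)).map (· % N) = (Finset.Ico 0 N).val ↔
      s.map (· % N) = (Finset.Ico 0 N).val := by
  refine ⟨fun h => ?_, residues_shift hN m s⟩
  simpa using residues_shift hN (-m) _ h

lemma eq_Ioo_val_iff {N : ℤ} (hN : 0 < N) (s : Multiset ℤ) :
    s = (Finset.Ioo 0 N).val ↔ 0 ::ₘ s = (Finset.Ico 0 N).val := by
  rw [← Finset.Ioo_insert_left hN, Finset.insert_val_of_notMem (by simp), Multiset.cons_inj_right]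

/-- Splitting a first passage walk at its lowest intermediate position `m`. -/
lemma split_mem_passagePairs_iff {N m t : ℤ} {L R : List ℤ} (hN : 0 < N) (hm : 0 < m)
    (hL : ∀ x ∈ L, m < x) (hR : ∀ x ∈ R, m < x) (ht : t < 0) :
    ((L.reverse.map (· - m), -m), (R.map (· - m), t - m)) ∈ passagePairs N ↔
      (L ++ m :: R, t) ∈ labelledPassage N (Finset.Ioo 0 N) := by
  have hres : residues N (L.reverse.map (· - m), -m) + residues N (R.map (· - m), t - m) =
      (Finset.Ioo 0 N).val ↔ residues N (L ++ m :: R, t) = (Finset.Ioo 0 N).val := by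
    rw [eq_Ioo_val_iff hN, eq_Ioo_val_iff hN,
      show 0 ::ₘ residues N (L ++ m :: R, t) =
        ((0 ::ₘ (((L ++ m :: R) ++ [t] : List ℤ) : Multiset ℤ))).map (· % N) by simp [residues],
      ← residues_shift_iff hN m]
    refine Eq.congr_left ?_
    rw [residues, residues, ← Multiset.map_add, ← Int.zero_emod N,
      ← Multiset.map_cons (· % N) 0, Int.zero_emod]
    congr 1
    simp only [Multiset.coe_add, Multiset.cons_coe, Multiset.map_coe, Multiset.coe_eq_coe]
    refine List.perm_iff_count.2 fun a => ?_
    simp only [List.count_append, List.count_cons, List.map_append, List.map_cons, List.map_reverse,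
      List.count_reverse, sub_self, zero_sub, List.map_nil, List.count_nil]
    ring
  have hchain : (0 :: ((L ++ m :: R) ++ [t])).IsChain (fun a b => |a - b| < N) ↔
      (0 :: (L.reverse.map (· - m) ++ [-m])).IsChain (fun a b => |a - b| < N) ∧
      (0 :: (R.map (· - m) ++ [t - m])).IsChain (fun a b => |a - b| < N) := by
    have h1 : (0 :: (L.reverse.map (· - m) ++ [-m])) = ((0 :: (L ++ [m])).reverse.map (· - m)) := by
      simp
    have h2 : (0 :: (R.map (· - m) ++ [t - m])) = ((m :: (R ++ [t])).map (· - m)) := by simp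
    have h3 : (0 :: ((L ++ m :: R) ++ [t])) = (0 :: L) ++ m :: (R ++ [t]) := by simp
    rw [h1, h2, h3, List.isChain_map, List.isChain_map, List.isChain_reverse, List.isChain_split]
    simp only [sub_sub_sub_cancel_right, List.cons_append]
    simp only [abs_sub_comm]
  simp only [passagePairs, labelledPassage, Set.mem_ofPred_eq, hres, firstPassage, hchain]
  constructor
  · rintro ⟨⟨-, -, h1⟩, ⟨-, -, h2⟩, h3⟩
    refine ⟨⟨?_, ht, h1, h2⟩, h3⟩
    intro x hx
    rcases List.mem_append.1 hx with hx | hx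
    · exact hm.trans (hL x hx)
    · rcases List.mem_cons.1 hx with rfl | hx
      · exact hm
      · exact hm.trans (hR x hx)
  · rintro ⟨⟨-, -, h1, h2⟩, h3⟩
    refine ⟨⟨?_, by omega, h1⟩, ⟨?_, by omega, h2⟩, h3⟩
    · simpa using hL
    · simpa using hR

lemma ncard_labelledPassage_eq_pairs {N : ℤ} (hN : 3 ≤ N) :
    (labelledPassage N (Finset.Ioo 0 N)).ncard =
      {q ∈ passagePairs N | q.2.2 < q.1.2}.ncard := by
  symm
  refine Set.ncard_congr (fun q _ => (q.1.1.reverse.map (· - q.1.2) ++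
    (-q.1.2) :: q.2.1.map (· - q.1.2), q.2.2 - q.1.2)) ?_ ?_ ?_
  · rintro ⟨⟨u, t⟩, ⟨u', t'⟩⟩ ⟨hq, hlt⟩
    obtain ⟨⟨hu, ht, -⟩, ⟨hu', ht', -⟩, -⟩ := id hq
    dsimp only at *
    refine (split_mem_passagePairs_iff (by omega) (by omega) ?_ ?_ (by omega)).1 ?_
    · simpa using hu
    · simpa using hu'
    · simpa [Function.comp_def] using hq
  · rintro ⟨⟨u, t⟩, ⟨u', t'⟩⟩ ⟨⟨v, s⟩, ⟨v', s'⟩⟩ ⟨⟨⟨hu, -, -⟩, ⟨hu', -, -⟩, -⟩, -⟩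
      ⟨⟨⟨hv, -, -⟩, ⟨hv', -, -⟩, -⟩, -⟩ h
    rw [Prod.mk.injEq] at h
    obtain ⟨h1, h2⟩ := h
    dsimp only at *
    have hmin : ∀ {l l' : List ℤ} {r x : ℤ}, (∀ x ∈ l, 0 < x) → (∀ x ∈ l', 0 < x) →
        x ∈ l.reverse.map (· - r) ++ (-r) :: l'.map (· - r) → -r ≤ x := by
      intro l l' r x hl hl' hx
      simp only [List.mem_append, List.mem_map, List.mem_reverse, List.mem_cons] at hx
      rcases hx with ⟨y, hy, rfl⟩ | rfl | ⟨y, hy, rfl⟩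
      · have := hl y hy; omega
      · exact le_rfl
      · have := hl' y hy; omega
    have h3 : -t ≤ -s := hmin hu hu' (by rw [h1]; simp)
    have h4 : -s ≤ -t := hmin hv hv' (by rw [← h1]; simp)
    obtain rfl : t = s := by omega
    have hnot : ∀ {l : List ℤ}, (∀ x ∈ l, 0 < x) → -t ∉ l.map (· - t) := by
      intro l hl hx
      obtain ⟨y, hy, h⟩ := List.mem_map.1 hx
      have := hl y hy
      omega
    have hinj : Function.Injective (List.map fun x : ℤ => x - t) :=
      List.map_injective_iff.2 (sub_left_injective)
    rw [List.append_cons_inj_of_notMem (by simpa using hnot hu) (hnot hu')] at h1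
    obtain rfl := List.reverse_injective (hinj h1.1)
    obtain rfl := hinj h1.2.2
    obtain rfl : t' = s' := by omega
    rfl
  · rintro ⟨u, t⟩ h
    have hu : u.toFinset.Nonempty := by
      have h1 := card_residues N (u, t)
      rw [h.2, Finset.card_val, Int.card_Ioo] at h1
      rw [List.toFinset_nonempty_iff]
      rintro rfl
      simp at h1
      omega
    obtain ⟨m, hmu, hmin⟩ := Finset.exists_min_image u.toFinset id hu
    obtain ⟨L, R, rfl⟩ := List.append_of_mem (List.mem_toFinset.1 hmu)
    have hnodup : (L ++ m :: R).Nodup := by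
      have h1 : (residues N (L ++ m :: R, t)).Nodup := by rw [h.2]; exact Finset.nodup _
      exact (List.nodup_append.1 (Multiset.coe_nodup.1 h1.of_map)).1
    have hm : 0 < m := h.1.1 m (by simp)
    have hL : ∀ x ∈ L, m < x := fun x hx =>
      lt_of_le_of_ne (hmin x (by simp [hx])) fun e =>
        (List.nodup_append.1 hnodup).2.2 x hx m (by simp) e.symm
    have hR : ∀ x ∈ R, m < x := fun x hx =>
      lt_of_le_of_ne (hmin x (by simp [hx])) fun e =>
        (List.nodup_cons.1 (List.nodup_append.1 hnodup).2.1).1 (e ▸ hx)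
    have ht : t < 0 := h.1.2.1
    refine ⟨((L.reverse.map (· - m), -m), (R.map (· - m), t - m)),
      ⟨(split_mem_passagePairs_iff (by omega) hm hL hR ht).2 h, ?_⟩, ?_⟩
    · dsimp only
      omega
    · simp [Function.comp_def]

lemma card_passagePairs (n : ℕ) :
    (passagePairs (n + 1)).Finite ∧ (passagePairs (n + 1)).ncard =
      ∑ k ∈ Finset.range (n + 1), n.choose k * (passageCount k * passageCount (n - k)) := by
  classical
  set N : ℤ := n + 1 with hN
  set F := Finset.Ioo 0 N with hF
  have hcard : F.card = n := by simp [hF, hN]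
  let T : Finset ℤ → Finset (List ℤ × ℤ) := fun S => (finite_labelledPassage N S).toFinset
  have hT : ∀ S w, w ∈ T S ↔ w ∈ firstPassage N ∧ residues N w = S.val := fun S w =>
    Set.Finite.mem_toFinset _
  have hTcard : ∀ S ⊆ F, (T S).card = passageCount S.card := fun S hS => by
    rw [← ncard_labelledPassage hS (by omega),
      Set.ncard_eq_toFinset_card _ (finite_labelledPassage N S)]
  have hset : passagePairs N = (F.powerset.biUnion fun S => T S ×ˢ T (F \ S) :) := by
    ext ⟨w, w'⟩
    simp only [Finset.coe_biUnion, Set.mem_iUnion, Finset.mem_coe, Finset.mem_powerset,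
      Finset.mem_product, hT, passagePairs, Set.mem_ofPred_eq]
    constructor
    · rintro ⟨hw, hw', h⟩
      have hnd : (residues N w).Nodup := Multiset.nodup_of_le (h ▸ Multiset.le_add_right _ _) F.nodup
      refine ⟨⟨residues N w, hnd⟩, ?_, ⟨hw, rfl⟩, hw', ?_⟩
      · rw [← Finset.val_le_iff, ← h]
        exact Multiset.le_add_right _ _
      · rw [Finset.sdiff_val, ← h, add_tsub_cancel_left]
    · rintro ⟨S, hS, ⟨hw, h⟩, hw', h'⟩
      refine ⟨hw, hw', ?_⟩
      rw [h, h', Finset.sdiff_val, add_tsub_cancel_of_le (Finset.val_le_iff.2 hS)]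
  refine ⟨hset ▸ Finset.finite_toSet _, ?_⟩
  rw [hset, Set.ncard_coe_finset, Finset.card_biUnion]
  · have h1 : ∀ S ∈ F.powerset, (T S ×ˢ T (F \ S)).card =
        passageCount S.card * passageCount (n - S.card) := by
      intro S hS
      rw [Finset.mem_powerset] at hS
      rw [Finset.card_product, hTcard S hS, hTcard _ Finset.sdiff_subset,
        Finset.card_sdiff_of_subset hS, hcard]
    rw [Finset.sum_congr rfl h1,
      Finset.sum_powerset_apply_card fun k => passageCount k * passageCount (n - k), hcard]
    simp only [smul_eq_mul]
  · intro S _ S' _ hne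
    refine Finset.disjoint_left.2 fun q hq hq' => hne ?_
    rw [Finset.mem_product, hT] at hq hq'
    exact Finset.val_injective (hq.1.2.symm.trans hq'.1.2)

lemma ncard_passagePairs_eq_two_mul {N : ℤ} (hfin : (passagePairs N).Finite) :
    (passagePairs N).ncard = 2 * {q ∈ passagePairs N | q.2.2 < q.1.2}.ncard := by
  have hunion : passagePairs N = {q ∈ passagePairs N | q.2.2 < q.1.2} ∪
      {q ∈ passagePairs N | q.1.2 < q.2.2} := by
    ext q
    simp only [Set.mem_union, Set.mem_ofPred_eq, ← and_or_left]
    refine ⟨fun h => ⟨h, ?_⟩, fun h => h.1⟩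
    refine lt_or_gt_of_ne fun e => ?_
    have hnd : (residues N q.1 + residues N q.2).Nodup := h.2.2 ▸ Finset.nodup _
    have h1 : q.1.2 % N ∈ residues N q.1 := by simp [residues]
    have h2 : q.1.2 % N ∈ residues N q.2 := by simp [residues, e]
    exact Multiset.disjoint_left.1 (Multiset.nodup_add.1 hnd).2.2 h1 h2
  have hswap : {q ∈ passagePairs N | q.1.2 < q.2.2} =
      Prod.swap '' {q ∈ passagePairs N | q.2.2 < q.1.2} := by
    ext ⟨w, w'⟩
    rw [Set.image_swap_eq_preimage_swap]
    simp only [Set.mem_preimage, passagePairs, Set.mem_ofPred_eq, Prod.swap_prod_mk,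
      add_comm (residues N w')]
    tauto
  conv_lhs => rw [hunion]
  rw [Set.ncard_union_eq _ (hfin.subset fun _ h => h.1) (hfin.subset fun _ h => h.1), hswap,
    Set.ncard_image_of_injective _ Prod.swap_injective, two_mul]
  refine Set.disjoint_left.2 fun q hq hq' => ?_
  exact lt_asymm hq.2 hq'.2

lemma two_mul_passageCount {n : ℕ} (hn : 2 ≤ n) :
    2 * passageCount n =
      ∑ k ∈ Finset.range (n + 1), n.choose k * (passageCount k * passageCount (n - k)) := by
  rw [← (card_passagePairs n).2, ncard_passagePairs_eq_two_mul (card_passagePairs n).1,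
    passageCount, ncard_labelledPassage_eq_pairs (by omega)]

lemma ofFn_mem_labelledPassage_iff {m : ℕ} (z : Fin (m + 1) → ℤ) :
    (List.ofFn fun i : Fin m => z i.castSucc, z (Fin.last m)) ∈
        labelledPassage (m + 2) (Finset.Ioo 0 ((m : ℤ) + 2)) ↔
      (∀ i : Fin m, 0 < z i.castSucc) ∧ z (Fin.last m) < 0 ∧ |z 0| < m + 2 ∧
        (∀ i : Fin m, |z i.castSucc - z i.succ| < m + 2) ∧
        (Function.Injective fun i => z i % ((m : ℤ) + 2)) ∧ ∀ i, z i % ((m : ℤ) + 2) ≠ 0 := by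
  set N : ℤ := m + 2 with hN
  have hlist : (List.ofFn fun i : Fin m => z i.castSucc) ++ [z (Fin.last m)] = List.ofFn z := by
    rw [List.ofFn_succ', List.concat_eq_append]
  have hchain : (0 :: List.ofFn z).IsChain (fun a b => |a - b| < N) ↔
      |z 0| < N ∧ ∀ i : Fin m, |z i.castSucc - z i.succ| < N := by
    have h1 : (0 :: List.ofFn z).IsChain (fun a b => |a - b| < N) ↔
        |z 0| < N ∧ (List.ofFn z).IsChain (fun a b => |a - b| < N) := by
      rw [List.ofFn_succ, List.isChain_cons_cons, zero_sub, abs_neg]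
    rw [h1, List.isChain_ofFn]
    refine and_congr_right fun _ => ⟨fun h i => h i (by omega), fun h i hi => h ⟨i, by omega⟩⟩
  have hres : residues N (List.ofFn fun i : Fin m => z i.castSucc, z (Fin.last m)) =
      (Finset.Ioo 0 N).val ↔ (Function.Injective fun i => z i % N) ∧ ∀ i, z i % N ≠ 0 := by
    have h1 : residues N (List.ofFn fun i : Fin m => z i.castSucc, z (Fin.last m)) =
        (List.ofFn fun i => z i % N : List ℤ) := by
      simp only [residues, hlist, Multiset.map_coe, List.map_ofFn, Function.comp_def]
    rw [h1]
    constructor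
    · intro h
      have hnd : (List.ofFn fun i => z i % N).Nodup := by
        rw [← Multiset.coe_nodup, h]; exact Finset.nodup _
      refine ⟨List.nodup_ofFn.1 hnd, fun i hi => ?_⟩
      have h2 : z i % N ∈ (Finset.Ioo 0 N).val := by
        rw [← h]; exact List.mem_ofFn.2 ⟨i, rfl⟩
      rw [hi, Finset.mem_val, Finset.mem_Ioo] at h2
      exact lt_irrefl _ h2.1
    · rintro ⟨hinj, h0⟩
      refine Multiset.eq_of_le_of_card_le ((Multiset.le_iff_subset
        (Multiset.coe_nodup.2 (List.nodup_ofFn.2 hinj))).2 ?_) (by simp [hN]; omega)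
      intro x hx
      obtain ⟨i, rfl⟩ := List.mem_ofFn.1 (Multiset.mem_coe.1 hx)
      exact Finset.mem_Ioo.2 ⟨lt_of_le_of_ne (Int.emod_nonneg _ (by omega)) (h0 i).symm,
        Int.emod_lt_of_pos _ (by omega)⟩
  simp only [labelledPassage, firstPassage, Set.mem_ofPred_eq, hlist, hchain, hres,
    List.forall_mem_ofFn_iff, and_assoc]

lemma psum_zero (n : ℕ) (p : Fin (n - 1) → ℤ) : psum n p 0 = 0 := by
  simp [psum]

lemma psum_succ (n : ℕ) (p : Fin (n - 1) → ℤ) (i : Fin (n - 1)) :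
    psum n p (i + 1) = psum n p i + p i := by
  have : (Finset.univ.filter fun j : Fin (n - 1) => j.1 < i.1 + 1) =
      insert i (Finset.univ.filter fun j : Fin (n - 1) => j.1 < i.1) := by
    ext j
    simp only [Finset.mem_filter, Finset.mem_univ, true_and, Finset.mem_insert, Fin.ext_iff]
    omega
  rw [psum, psum, this, Finset.sum_insert (by simp), add_comm]

lemma abs_sub_lt_iff_of_residues {N d a b : ℤ} (ha : 0 < a) (haN : a < N) (hb : 0 < b)
    (hbN : b < N) :
    |a - (N * d + b)| < N ↔ d = 0 ∨ (d = -1 ∧ a < b) ∨ (d = 1 ∧ b < a) := by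
  rw [abs_lt]
  constructor
  · rintro ⟨h1, h2⟩
    have h3 : d < 2 := by nlinarith
    have h4 : -2 < d := by nlinarith
    obtain rfl | rfl | rfl : d = -1 ∨ d = 0 ∨ d = 1 := by omega
    all_goals omega
  · rintro (rfl | ⟨rfl, h⟩ | ⟨rfl, h⟩) <;> constructor <;> omega

/-- The walk attached to a word and a permutation: the partial sums of the word are the quotients
and the labels are the residues. -/
def walkOf (m : ℕ) (p : Fin (m + 1 - 1) → ℤ) (σ : Equiv.Perm (Fin (m + 1))) (i : Fin (m + 1)) : ℤ :=
  (m + 2) * psum (m + 1) p i + ((σ i : ℕ) + 1)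

lemma walkOf_ediv_emod (m : ℕ) (p : Fin (m + 1 - 1) → ℤ) (σ : Equiv.Perm (Fin (m + 1)))
    (i : Fin (m + 1)) :
    walkOf m p σ i / (m + 2) = psum (m + 1) p i ∧ walkOf m p σ i % (m + 2) = (σ i : ℕ) + 1 := by
  have := (σ i).isLt
  exact (Int.ediv_emod_unique (by omega)).2 ⟨by rw [walkOf]; ring, by omega, by omega⟩

lemma walkOf_mem_iff {m : ℕ} (hm : 1 ≤ m) (p : Fin (m + 1 - 1) → ℤ)
    (σ : Equiv.Perm (Fin (m + 1))) :
    (List.ofFn fun i : Fin m => walkOf m p σ i.castSucc, walkOf m p σ (Fin.last m)) ∈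
        labelledPassage (m + 2) (Finset.Ioo 0 ((m : ℤ) + 2)) ↔ IsMotzkinPath (m + 1) p σ := by
  have hσ : ∀ i, 0 < ((σ i : ℕ) : ℤ) + 1 ∧ ((σ i : ℕ) : ℤ) + 1 < m + 2 := fun i => by
    have := (σ i).isLt
    omega
  have hpos : ∀ i, 0 < walkOf m p σ i ↔ 0 ≤ psum (m + 1) p i := fun i => by
    have := hσ i
    rw [walkOf]
    constructor <;> intro <;> nlinarith
  have hneg : ∀ i, walkOf m p σ i < 0 ↔ psum (m + 1) p i < 0 := fun i => by
    have := hσ i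
    rw [walkOf]
    constructor <;> intro <;> nlinarith
  have hstep : ∀ i : Fin m, |walkOf m p σ i.castSucc - walkOf m p σ i.succ| < m + 2 ↔
      p i = 0 ∨ (p i = -1 ∧ σ i.castSucc < σ i.succ) ∨ (p i = 1 ∧ σ i.succ < σ i.castSucc) := by
    intro i
    have h1 := abs_sub_lt_iff_of_residues (d := p i) (hσ i.castSucc).1 (hσ i.castSucc).2
      (hσ i.succ).1 (hσ i.succ).2
    have h2 : walkOf m p σ i.castSucc - walkOf m p σ i.succ =
        (((σ i.castSucc : ℕ) : ℤ) + 1) - ((m + 2) * p i + (((σ i.succ : ℕ) : ℤ) + 1)) := by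
      have := psum_succ (m + 1) p i
      simp only [walkOf, Fin.val_castSucc, Fin.val_succ, this]
      ring
    rw [h2, h1, Fin.lt_def, Fin.lt_def]
    omega
  have hinj : Function.Injective fun i => walkOf m p σ i % ((m : ℤ) + 2) := by
    intro i j hij
    simp only [(walkOf_ediv_emod m p σ _).2] at hij
    exact σ.injective (Fin.ext (by omega))
  have hne : ∀ i, walkOf m p σ i % ((m : ℤ) + 2) ≠ 0 := fun i => by
    rw [(walkOf_ediv_emod m p σ i).2]
    omega
  have h0 : |walkOf m p σ 0| < m + 2 := by
    have := hσ 0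
    rw [walkOf, Fin.val_zero, psum_zero, abs_lt]
    constructor <;> linarith
  rw [ofFn_mem_labelledPassage_iff]
  simp only [hpos, hneg, hstep, h0, hinj, hne, true_and, and_true, ne_eq, not_false_eq_true,
    implies_true]
  constructor
  · rintro ⟨h1, h2, h3⟩
    refine ⟨fun i => ?_, fun i => ⟨fun h => ?_, fun h => ?_⟩, fun j hj => ?_, ?_⟩
    · rcases h3 i with h | h | h
      · exact Or.inr (Or.inl h)
      · exact Or.inl h.1
      · exact Or.inr (Or.inr h.1)
    · rcases h3 i with h' | h' | h'
      · omega
      · exact h'.2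
      · omega
    · rcases h3 i with h' | h' | h'
      · omega
      · omega
      · exact h'.2
    · exact h1 ⟨j, by omega⟩
    · have h4 := psum_succ (m + 1) p ⟨m - 1, by omega⟩
      have h5 := h1 ⟨m - 1, by omega⟩
      have h6 := h3 ⟨m - 1, by omega⟩
      simp only [Fin.val_castSucc, Fin.val_last, Nat.sub_add_cancel hm] at h2 h4 h5
      rw [Nat.add_sub_cancel]
      omega
  · rintro ⟨h1, h2, h3, h4⟩
    refine ⟨fun i => h3 i (by have := i.isLt; simp; omega), ?_, fun i => ?_⟩
    · have : psum (m + 1) p m = -1 := h4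
      rw [Fin.val_last, this]
      norm_num
    · rcases h1 i with h | h | h
      · exact Or.inr (Or.inl ⟨h, (h2 i).1 h⟩)
      · exact Or.inl h
      · exact Or.inr (Or.inr ⟨h, (h2 i).2 h⟩)

lemma motzkinCount_eq_passageCount {m : ℕ} (hm : 1 ≤ m) :
    motzkinCount (m + 1) = passageCount (m + 1) := by
  have hN : ((m + 1 : ℕ) : ℤ) + 1 = m + 2 := by push_cast; ring
  rw [passageCount, hN]
  refine Set.ncard_congr (s := {ps : (Fin (m + 1 - 1) → ℤ) × Equiv.Perm (Fin (m + 1)) |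
    IsMotzkinPath (m + 1) ps.1 ps.2}) (fun ps _ =>
    (List.ofFn fun i : Fin m => walkOf m ps.1 ps.2 i.castSucc, walkOf m ps.1 ps.2 (Fin.last m)))
    ?_ ?_ ?_
  · rintro ⟨p, σ⟩ h
    exact (walkOf_mem_iff hm p σ).2 h
  · rintro ⟨p, σ⟩ ⟨p', σ'⟩ - - h
    obtain ⟨h1, h2⟩ := Prod.mk.inj h
    have hz : walkOf m p σ = walkOf m p' σ' := by
      ext i
      refine Fin.lastCases h2 (fun j => ?_) i
      exact congrFun (List.ofFn_injective h1) j
    have hσ : σ = σ' := by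
      ext i
      have h3 := (walkOf_ediv_emod m p σ i).2
      rw [hz, (walkOf_ediv_emod m p' σ' i).2] at h3
      omega
    have hs : ∀ i : Fin (m + 1), psum (m + 1) p i = psum (m + 1) p' i := fun i => by
      rw [← (walkOf_ediv_emod m p σ i).1, ← (walkOf_ediv_emod m p' σ' i).1, hz]
    have hp : p = p' := by
      ext i
      have h3 := psum_succ (m + 1) p i
      have h4 := psum_succ (m + 1) p' i
      have h5 := hs (Fin.castSucc (n := m) i)
      have h6 := hs (Fin.succ (n := m) i)
      simp only [Fin.val_castSucc, Fin.val_succ] at h5 h6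
      omega
    rw [hp, hσ]
  · rintro ⟨u, t⟩ h
    have hlen : u.length = m := by
      have h1 := card_residues (m + 2) (u, t)
      rw [h.2, Finset.card_val, Int.card_Ioo] at h1
      dsimp only at h1
      omega
    obtain ⟨f, rfl⟩ : ∃ f : Fin m → ℤ, u = List.ofFn f := by
      subst hlen
      exact ⟨u.get, (List.ofFn_get u).symm⟩
    obtain ⟨z, rfl, rfl⟩ : ∃ z : Fin (m + 1) → ℤ, f = (fun i => z i.castSucc) ∧ t = z (Fin.last m) :=
      ⟨Fin.snoc (α := fun _ => ℤ) f t, by simp, by simp⟩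
    obtain ⟨h1, h2, h3, h4, h5, h6⟩ := (ofFn_mem_labelledPassage_iff z).1 h
    have hz0 : z 0 / (m + 2) = 0 :=
      Int.ediv_eq_zero_of_lt (h1 ⟨0, hm⟩).le (abs_lt.1 h3).2
    have hb : ∀ i, 0 < z i % ((m : ℤ) + 2) ∧ z i % ((m : ℤ) + 2) < m + 2 := fun i =>
      ⟨lt_of_le_of_ne (Int.emod_nonneg _ (by omega)) (h6 i).symm, Int.emod_lt_of_pos _ (by omega)⟩
    let g : Fin (m + 1) → Fin (m + 1) := fun i =>
      ⟨(z i % ((m : ℤ) + 2) - 1).toNat, by have := hb i; omega⟩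
    have hg : Function.Injective g := by
      intro i j hij
      have h7 := Fin.mk.inj hij
      have := hb i
      have := hb j
      exact h5 (by dsimp only; omega)
    let σ : Equiv.Perm (Fin (m + 1)) := Equiv.ofBijective g (Finite.injective_iff_bijective.1 hg)
    let p : Fin (m + 1 - 1) → ℤ := fun i =>
      z (Fin.succ (n := m) i) / (m + 2) - z (Fin.castSucc (n := m) i) / (m + 2)
    have hs : ∀ i : Fin (m + 1), psum (m + 1) p i = z i / (m + 2) := by
      intro i
      induction i using Fin.induction with
      | zero => rw [hz0, Fin.val_zero, psum_zero]
      | succ i ih =>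
        rw [Fin.val_succ, psum_succ (m + 1) p i]
        rw [Fin.val_castSucc] at ih
        rw [ih]
        exact add_sub_cancel _ _
    have hw : walkOf m p σ = z := by
      ext i
      have h7 : ((σ i : ℕ) : ℤ) + 1 = z i % ((m : ℤ) + 2) := by
        have := hb i
        change (((z i % ((m : ℤ) + 2) - 1).toNat : ℕ) : ℤ) + 1 = _
        omega
      rw [walkOf, hs, h7]
      exact Int.mul_ediv_add_emod _ _
    refine ⟨(p, σ), (walkOf_mem_iff hm p σ).1 ?_, ?_⟩
    · rwa [hw]
    · simp only [hw]

lemma motzkinCount_zero : motzkinCount 0 = 0 := by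
  rw [motzkinCount, Nat.card_eq_zero]
  refine Or.inl ⟨fun ps => ?_⟩
  have := ps.2.2.2.2
  rw [psum_zero] at this
  omega

lemma motzkinCount_one : motzkinCount 1 = 0 := by
  rw [motzkinCount, Nat.card_eq_zero]
  refine Or.inl ⟨fun ps => ?_⟩
  have := ps.2.2.2.2
  rw [psum_zero] at this
  omega

lemma passageCount_zero : passageCount 0 = 0 := by
  rw [passageCount, Set.ncard_eq_zero (finite_labelledPassage _ _), Set.eq_empty_iff_forall_notMem]
  intro w hw
  have := card_residues (((0 : ℕ) : ℤ) + 1) w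
  rw [hw.2] at this
  simp at this

lemma passageCount_one : passageCount 1 = 1 := by
  rw [passageCount, Set.ncard_eq_one]
  refine ⟨([], -1), Set.eq_singleton_iff_unique_mem.2 ⟨⟨⟨by simp, by simp, by simp⟩, ?_⟩, ?_⟩⟩
  · decide
  · rintro ⟨u, t⟩ ⟨⟨hu, ht, hc⟩, hr⟩
    have h1 := card_residues (((1 : ℕ) : ℤ) + 1) (u, t)
    rw [hr] at h1
    obtain rfl : u = [] := by simpa using h1
    simp only [List.nil_append, List.isChain_cons_cons, abs_lt] at hc
    have : t = -1 := by dsimp only at ht; push_cast at hc; omega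
    rw [this]

lemma passageCount_eq (n : ℕ) : passageCount n = motzkinCount n + if n = 1 then 1 else 0 := by
  rcases n with _ | _ | m
  · simp [passageCount_zero, motzkinCount_zero]
  · simp [passageCount_one, motzkinCount_one]
  · simp [motzkinCount_eq_passageCount (m := m + 1) (by omega)]

/-- Recurrence for the numbers `a_n` of well-labelled Motzkin paths:
`a_n = [n=2] + n·a_{n-1} + (1/2)·Σ_{k=0}^{n} C(n,k)·a_k·a_{n-k}`. -/
theorem motzkin_count_recurrence (n : ℕ) :
    (motzkinCount n : ℚ) =
      (if n = 2 then 1 else 0) + (n : ℚ) * (motzkinCount (n - 1) : ℚ) +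
        (1 / 2) * ∑ k ∈ Finset.range (n + 1),
          (n.choose k : ℚ) * (motzkinCount k : ℚ) * (motzkinCount (n - k) : ℚ) := by
  rcases Nat.lt_or_ge n 2 with hn | hn
  · interval_cases n <;> simp [Finset.sum_range_succ, motzkinCount_zero, motzkinCount_one]
  have h1 : (2 : ℚ) * passageCount n = ∑ k ∈ Finset.range (n + 1),
      (n.choose k : ℚ) * (passageCount k * passageCount (n - k)) := by
    exact_mod_cast two_mul_passageCount hn
  have h2 : (passageCount n : ℚ) = motzkinCount n := by
    rw [passageCount_eq, if_neg (by omega), add_zero]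
  have h3 : ∀ k ∈ Finset.range (n + 1),
      (n.choose k : ℚ) * (passageCount k * passageCount (n - k)) =
        (n.choose k : ℚ) * motzkinCount k * motzkinCount (n - k) +
        (if k = n - 1 then (n.choose k : ℚ) * motzkinCount k else 0) +
        (if k = 1 then (n.choose k : ℚ) * motzkinCount (n - k) else 0) +
        (if k = 1 then (if n = 2 then 2 else 0) else 0) := by
    intro k hk
    have hk' : k ≤ n := Finset.mem_range_succ_iff.1 hk
    rw [passageCount_eq, passageCount_eq]
    by_cases h : k = 1
    · subst h
      by_cases h' : n = 2
      · subst h'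
        simp [motzkinCount_one]
      · rw [if_neg (by omega : ¬ n - 1 = 1), if_neg (by omega : ¬ 1 = n - 1)]
        simp [h', motzkinCount_one]
    · by_cases h' : k = n - 1
      · rw [if_pos (by omega : n - k = 1), if_pos h']
        simp [h]
        ring
      · rw [if_neg (by omega : ¬ n - k = 1), if_neg h']
        simp [h]
        ring
  rw [h2, Finset.sum_congr rfl h3, Finset.sum_add_distrib, Finset.sum_add_distrib,
    Finset.sum_add_distrib, Finset.sum_ite_eq', Finset.sum_ite_eq', Finset.sum_ite_eq',
    if_pos (Finset.mem_range.2 (by omega)), if_pos (Finset.mem_range.2 (by omega)),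
    if_pos (Finset.mem_range.2 (by omega)), Nat.choose_one_right,
    ← Nat.choose_symm (by omega : n - 1 ≤ n), Nat.sub_sub_self (by omega),
    Nat.choose_one_right] at h1
  split_ifs at h1 ⊢ <;> linarith
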